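/- Fix an integer d ≥ 3 and a real ν > 0 (possibly non-integer). Let κ : [−1,1] → ℝ be C^∞ on (−1,1) and assume that for every integer j ≥ 0 there exist real polynomials p_{j,1}, p_{j,−1} such that κ^{(j)}(t) = p_{j,1}(1−t) + O((1−t)^{ν−j}) as t → 1⁻ and κ^{(j)}(t) = p_{j,−1}(1+t) + O((1+t)^{ν−j}) as t → −1⁺. Then μ_k(κ) = O(k^{−d−2ν+3}) as k → ∞. -/

import Mathlib

open Filter Asymptotics Real Set Topology

/-- Legendre polynomial of degree `k` in dimension `d` (Rodrigues formula). -/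
noncomputable def legendreP (d k : ℕ) (t : ℝ) : ℝ :=
  (-1 / 2 : ℝ) ^ k * (Real.Gamma (((d : ℝ) - 1) / 2) / Real.Gamma ((k : ℝ) + ((d : ℝ) - 1) / 2)) *
    (1 - t ^ 2) ^ ((3 - (d : ℝ)) / 2) *
    iteratedDeriv k (fun s : ℝ => (1 - s ^ 2) ^ ((k : ℝ) + ((d : ℝ) - 3) / 2)) t

/-- Surface area `ω_{p-1}` of the unit sphere in `ℝ^p`. -/
noncomputable def sphereSurface (p : ℕ) : ℝ :=
  2 * Real.pi ^ ((p : ℝ) / 2) / Real.Gamma ((p : ℝ) / 2)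

/-- `μ_k(κ)`, the `k`-th Legendre coefficient of `κ` in dimension `d`. -/
noncomputable def legendreCoeff (d k : ℕ) (κ : ℝ → ℝ) : ℝ :=
  (sphereSurface (d - 1) / sphereSurface d) *
    ∫ t in (-1 : ℝ)..1, κ t * legendreP d k t * (1 - t ^ 2) ^ (((d : ℝ) - 3) / 2)


/-- Rodrigues polynomials: the `n`-th derivative of `(1-t²)^β` is `rodQ β n * (1-t²)^(β-n)`. -/
noncomputable def rodQ (β : ℝ) : ℕ → Polynomial ℝ
  | 0 => 1
  | n + 1 => (1 - Polynomial.X ^ 2) * Polynomial.derivative (rodQ β n)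
      - Polynomial.C (2 * (β - n)) * Polynomial.X * rodQ β n

lemma rodQ_eval_succ (β : ℝ) (n : ℕ) (t : ℝ) :
    (rodQ β (n + 1)).eval t = (1 - t ^ 2) * (Polynomial.derivative (rodQ β n)).eval t
      - 2 * (β - n) * t * (rodQ β n).eval t := by
  simp [rodQ]

lemma rodQ_deriv (β : ℝ) (n : ℕ) :
    Polynomial.derivative (rodQ β (n + 1)) =
      Polynomial.C (-((n + 1) * (2 * β - n))) * rodQ β n := by
  induction n with
  | zero => simp [rodQ]
  | succ n ih =>
    have h1 : rodQ β (n + 1) = (1 - Polynomial.X ^ 2) * Polynomial.derivative (rodQ β n)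
      - Polynomial.C (2 * (β - n)) * Polynomial.X * rodQ β n := rfl
    have h2 : rodQ β (n + 1 + 1) = (1 - Polynomial.X ^ 2) *
        (Polynomial.C (-((n + 1) * (2 * β - n))) * rodQ β n)
      - Polynomial.C (2 * (β - (n + 1 : ℕ))) * Polynomial.X * rodQ β (n + 1) := by
      rw [← ih]; rfl
    rw [h2]
    simp only [Polynomial.derivative_sub, Polynomial.derivative_mul, Polynomial.derivative_C,
      Polynomial.derivative_X, Polynomial.derivative_one, Polynomial.derivative_X_pow, ih]
    apply Polynomial.funext
    intro t
    have h3 := congrArg (Polynomial.eval t) h1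
    simp at h3 ⊢
    linear_combination (((n:ℝ) + 1) * (2 * β - n)) * h3

lemma rodQ_hasDerivAt (β : ℝ) (n : ℕ) (t : ℝ) :
    HasDerivAt (fun s => (rodQ β (n + 1)).eval s)
      (-((n + 1) * (2 * β - n)) * (rodQ β n).eval t) t := by
  have := (rodQ β (n + 1)).hasDerivAt t
  rw [rodQ_deriv] at this
  simpa using this

/-- three-term recurrence -/
lemma rodQ_rec (β : ℝ) (n : ℕ) (t : ℝ) :
    (rodQ β (n + 2)).eval t = - ((n + 1) * (2 * β - n)) * (1 - t ^ 2) * (rodQ β n).eval t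
      - 2 * (β - (n + 1)) * t * (rodQ β (n + 1)).eval t := by
  rw [rodQ_eval_succ, rodQ_deriv]
  simp
  ring

lemma one_sub_sq_pos {t : ℝ} (ht : t ∈ Ioo (-1 : ℝ) 1) : 0 < 1 - t ^ 2 := by
  nlinarith [ht.1, ht.2]

lemma rod_hasDerivAt (β γ : ℝ) (n : ℕ) (t : ℝ) (ht : t ∈ Ioo (-1 : ℝ) 1) (hγ : γ = β - n) :
    HasDerivAt (fun s => (rodQ β n).eval s * (1 - s ^ 2) ^ γ)
      ((rodQ β (n + 1)).eval t * (1 - t ^ 2) ^ (γ - 1)) t := by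
  have hw := one_sub_sq_pos ht
  have h1 : HasDerivAt (fun s : ℝ => 1 - s ^ 2) (-(2 * t)) t := by
    simpa using ((hasDerivAt_id t).pow 2).const_sub 1
  have h2 := h1.rpow_const (p := γ) (Or.inl hw.ne')
  have h3 := ((rodQ β n).hasDerivAt t).mul h2
  refine h3.congr_deriv ?_
  rw [rodQ_eval_succ]
  have : (1 - t ^ 2) ^ γ = (1 - t ^ 2) * (1 - t ^ 2) ^ (γ - 1) := by
    rw [Real.rpow_sub_one hw.ne']; field_simp
  rw [this, hγ]
  ring

lemma rod_iteratedDeriv (β : ℝ) (n : ℕ) (t : ℝ) (ht : t ∈ Ioo (-1 : ℝ) 1) :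
    iteratedDeriv n (fun s : ℝ => (1 - s ^ 2) ^ β) t =
      (rodQ β n).eval t * (1 - t ^ 2) ^ (β - n) := by
  induction n generalizing t with
  | zero => simp [rodQ]
  | succ n ih =>
    rw [iteratedDeriv_succ]
    have : iteratedDeriv n (fun s : ℝ => (1 - s ^ 2) ^ β) =ᶠ[𝓝 t]
        fun s => (rodQ β n).eval s * (1 - s ^ 2) ^ (β - n) := by
      filter_upwards [isOpen_Ioo.mem_nhds ht] with s hs using ih s hs
    rw [this.deriv_eq, (rod_hasDerivAt β (β - n) n t ht rfl).deriv]
    push_cast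
    ring_nf

lemma rodQ_one (β : ℝ) (n : ℕ) :
    (rodQ β (n + 1)).eval 1 = - (2 * (β - n)) * (rodQ β n).eval 1 := by
  rw [rodQ_eval_succ]; ring

lemma rodQ_neg_one (β : ℝ) (n : ℕ) : |(rodQ β n).eval (-1)| = |(rodQ β n).eval 1| := by
  induction n with
  | zero => simp [rodQ]
  | succ n ih =>
    rw [rodQ_one, rodQ_eval_succ, abs_mul, ← ih, ← abs_mul, ← abs_neg]
    congr 1; ring

lemma rodQ_one_gamma (α : ℝ) (hα : 0 ≤ α) (k n : ℕ) (hn : n ≤ k) :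
    (rodQ (k + α) n).eval 1 * Gamma (k + α - n + 1) = (-2) ^ n * Gamma (k + α + 1) := by
  induction n with
  | zero => simp [rodQ]
  | succ n ih =>
    have h := ih (by omega)
    have hk : (n : ℝ) + 1 ≤ k := by exact_mod_cast hn
    have hG : Gamma ((k + α - n) + 1) = (k + α - n) * Gamma (k + α - n) :=
      Real.Gamma_add_one (by linarith)
    rw [hG] at h
    rw [rodQ_one]
    push_cast
    rw [show (k : ℝ) + α - (n + 1) + 1 = k + α - n by ring, pow_succ]
    linear_combination (-2) * h

lemma norm_const (α : ℝ) (hα : 0 ≤ α) (k : ℕ) :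
    ((-1 / 2 : ℝ) ^ k * (Gamma (α + 1) / Gamma (k + α + 1))) * (rodQ (k + α) k).eval 1 = 1 := by
  have h := rodQ_one_gamma α hα k k le_rfl
  rw [show (k : ℝ) + α - k + 1 = α + 1 by ring] at h
  have hp : 0 < Gamma ((k : ℝ) + α + 1) := Real.Gamma_pos_of_pos (by positivity)
  have h2 : (-1 / 2 : ℝ) ^ k * (-2) ^ k = 1 := by rw [← mul_pow]; norm_num
  field_simp
  linear_combination (-1/2:ℝ)^k * h + Gamma ((k : ℝ) + α + 1) * h2

/-- Sonin-type bound. -/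
lemma sonin (y dy ddy : ℝ → ℝ) (l b : ℝ) (hl : 0 < l) (hb : 0 ≤ b)
    (h1 : ∀ t, HasDerivAt y (dy t) t) (h2 : ∀ t, HasDerivAt dy (ddy t) t)
    (ode : ∀ t, (1 - t ^ 2) * ddy t - (b + 1) * t * dy t + l * y t = 0)
    (hy1 : |y 1| ≤ 1) (hy2 : |y (-1)| ≤ 1) (t : ℝ) (ht : t ∈ Icc (-1 : ℝ) 1) :
    y t ^ 2 + (1 - t ^ 2) * dy t ^ 2 / l ≤ 1 := by
  set S : ℝ → ℝ := fun t => y t ^ 2 + (1 - t ^ 2) * dy t ^ 2 / l with hS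
  have hd : ∀ t, HasDerivAt S (2 * b * t * dy t ^ 2 / l) t := by
    intro t
    have e : HasDerivAt (fun s : ℝ => 1 - s ^ 2) (-(2 * t)) t := by
      simpa using ((hasDerivAt_id t).pow 2).const_sub 1
    have h := ((h1 t).pow 2).add ((e.mul ((h2 t).pow 2)).div_const l)
    refine h.congr_deriv ?_
    have := ode t
    simp
    field_simp
    linear_combination dy t * this
  have hc : Continuous S := continuous_iff_continuousAt.2 fun t => (hd t).continuousAt
  have e1 : S 1 ≤ 1 := by simpa [hS] using hy1
  have e2 : S (-1) ≤ 1 := by simpa [hS] using hy2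
  change S t ≤ 1
  rcases le_total 0 t with h0 | h0
  · have : MonotoneOn S (Icc 0 1) := by
      apply monotoneOn_of_deriv_nonneg (convex_Icc _ _) hc.continuousOn
      · exact fun x _ => (hd x).differentiableAt.differentiableWithinAt
      · intro x hx
        rw [interior_Icc] at hx
        rw [(hd x).deriv]
        have := hx.1
        positivity
    exact (this ⟨h0, ht.2⟩ ⟨zero_le_one, le_rfl⟩ ht.2).trans e1
  · have : AntitoneOn S (Icc (-1) 0) := by
      apply antitoneOn_of_deriv_nonpos (convex_Icc _ _) hc.continuousOn
      · exact fun x _ => (hd x).differentiableAt.differentiableWithinAt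
      · intro x hx
        rw [interior_Icc] at hx
        rw [(hd x).deriv]
        have : 0 ≤ 2 * b * (-x) * dy x ^ 2 / l := by
          have := neg_pos.2 hx.2
          positivity
        have e : 2 * b * (-x) * dy x ^ 2 / l = - (2 * b * x * dy x ^ 2 / l) := by ring
        linarith
    exact (this ⟨le_rfl, by norm_num⟩ ⟨ht.1, h0⟩ ht.1).trans e2

/-- The normalised polynomials. -/
noncomputable def nY (c α : ℝ) (k j : ℕ) (t : ℝ) : ℝ := c * (rodQ (k + α) (k - j)).eval t

lemma nY_deriv (c α : ℝ) (k j : ℕ) (hj : j < k) (t : ℝ) :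
    HasDerivAt (nY c α k j) (-((k - j) * (k + 2 * α + 1 + j)) * nY c α k (j + 1) t) t := by
  obtain ⟨n, rfl⟩ : ∃ n, k = n + 1 + j := ⟨k - j - 1, by omega⟩
  have h := (rodQ_hasDerivAt ((n + 1 + j : ℕ) + α) n t).const_mul c
  unfold nY
  rw [show n + 1 + j - j = n + 1 by omega, show n + 1 + j - (j + 1) = n by omega]
  refine h.congr_deriv ?_
  push_cast
  ring

lemma nY_rec (c α : ℝ) (k j : ℕ) (hj : j + 1 < k) (t : ℝ) :
    ((k - (j + 1)) * (k + 2 * α + 1 + (j + 1))) * (1 - t ^ 2) * nY c α k (j + 2) t =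
      - (nY c α k j t + 2 * (α + j + 1) * t * nY c α k (j + 1) t) := by
  obtain ⟨n, rfl⟩ : ∃ n, k = n + 2 + j := ⟨k - j - 2, by omega⟩
  have h := rodQ_rec ((n + 2 + j : ℕ) + α) n t
  unfold nY
  rw [show n + 2 + j - j = n + 2 by omega, show n + 2 + j - (j + 1) = n + 1 by omega,
    show n + 2 + j - (j + 2) = n by omega, h]
  push_cast
  ring

lemma nY_one (c α : ℝ) (hα : 0 ≤ α) (k j : ℕ) (hj : j ≤ k) (hc : |nY c α k 0 1| ≤ 1) :
    |nY c α k j 1| ≤ 1 := by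
  induction j with
  | zero => exact hc
  | succ j ih =>
    have h := ih (by omega)
    obtain ⟨n, rfl⟩ : ∃ n, k = n + 1 + j := ⟨k - j - 1, by omega⟩
    unfold nY at h ⊢
    rw [show n + 1 + j - j = n + 1 by omega, rodQ_one] at h
    rw [show n + 1 + j - (j + 1) = n by omega]
    rw [mul_left_comm, abs_mul] at h
    have : 1 ≤ |-(2 * (((n + 1 + j : ℕ) : ℝ) + α - n))| := by
      rw [abs_neg]
      refine le_trans ?_ (le_abs_self _)
      push_cast
      have : (0 : ℝ) ≤ j := by positivity
      linarith
    nlinarith [abs_nonneg (c * Polynomial.eval 1 (rodQ (((n + 1 + j : ℕ) : ℝ) + α) n))]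

lemma nY_sonin (c α : ℝ) (hα : 0 ≤ α) (k j : ℕ) (hj : j + 1 < k) (hc : |nY c α k 0 1| ≤ 1)
    (t : ℝ) (ht : t ∈ Icc (-1 : ℝ) 1) :
    nY c α k j t ^ 2 + (1 - t ^ 2) *
      (-((k - j) * (k + 2 * α + 1 + j)) * nY c α k (j + 1) t) ^ 2 /
        ((k - j) * (k + 2 * α + 1 + j)) ≤ 1 := by
  have hk : (j : ℝ) + 1 < k := by exact_mod_cast hj
  have hj0 : (0 : ℝ) ≤ j := by positivity
  have hl : 0 < ((k : ℝ) - j) * (k + 2 * α + 1 + j) := by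
    apply mul_pos <;> linarith
  have h1 := nY_one c α hα k j (by omega) hc
  refine sonin (nY c α k j) _ (fun t => -((k - j) * (k + 2 * α + 1 + j)) *
    (-((k - (j + 1 : ℕ)) * (k + 2 * α + 1 + (j + 1 : ℕ))) * nY c α k (j + 2) t)) _
    (2 * (α + j) + 1) hl (by linarith) (nY_deriv c α k j (by omega))
    (fun t => (nY_deriv c α k (j + 1) (by omega) t).const_mul _) ?_ h1 ?_ t ht
  · intro t
    have := nY_rec c α k j hj t
    push_cast
    linear_combination ((k : ℝ) - j) * (k + 2 * α + 1 + j) * this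
  · unfold nY at h1 ⊢
    rwa [abs_mul, rodQ_neg_one, ← abs_mul]

lemma nY_le_one (c α : ℝ) (hα : 0 ≤ α) (k j : ℕ) (hj : j + 1 < k) (hc : |nY c α k 0 1| ≤ 1)
    (t : ℝ) (ht : t ∈ Icc (-1 : ℝ) 1) : |nY c α k j t| ≤ 1 := by
  have h := nY_sonin c α hα k j hj hc t ht
  have hk : (j : ℝ) + 1 < k := by exact_mod_cast hj
  have hj0 : (0 : ℝ) ≤ j := by positivity
  have hl : 0 < ((k : ℝ) - j) * (k + 2 * α + 1 + j) := by
    apply mul_pos <;> linarith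
  have hw : 0 ≤ 1 - t ^ 2 := by nlinarith [ht.1, ht.2]
  have : 0 ≤ (1 - t ^ 2) *
      (-((k - j) * (k + 2 * α + 1 + j)) * nY c α k (j + 1) t) ^ 2 /
        ((k - j) * (k + 2 * α + 1 + j)) := by positivity
  exact (sq_le_one_iff_abs_le_one _).1 (by linarith)

lemma nY_one_decay (c α : ℝ) (hα : 0 ≤ α) (k : ℕ) (hk : 1 < k) (hc : |nY c α k 0 1| ≤ 1)
    (t : ℝ) (ht : t ∈ Icc (-1 : ℝ) 1) : |nY c α k 1 t| * (k * √(1 - t ^ 2)) ≤ 1 := by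
  have h := nY_sonin c α hα k 0 (by omega) hc t ht
  have hk' : (1 : ℝ) < k := by exact_mod_cast hk
  have hw : 0 ≤ 1 - t ^ 2 := by nlinarith [ht.1, ht.2]
  have hl : 0 < (k : ℝ) * (k + 2 * α + 1) := by positivity
  have h2 : (1 - t ^ 2) * ((k : ℝ) * (k + 2 * α + 1)) * nY c α k 1 t ^ 2 ≤ 1 := by
    have e : (1 - t ^ 2) * ((k : ℝ) * (k + 2 * α + 1)) * nY c α k 1 t ^ 2 = (1 - t ^ 2) *
      (-(((k : ℝ) - (0 : ℕ)) * (k + 2 * α + 1 + (0 : ℕ))) * nY c α k (0 + 1) t) ^ 2 /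
        (((k : ℝ) - (0 : ℕ)) * (k + 2 * α + 1 + (0 : ℕ))) := by
      simp; field_simp
    rw [e]; nlinarith [sq_nonneg (nY c α k 0 t)]
  have h3 : (1 - t ^ 2) * ((k : ℝ) * k) * nY c α k 1 t ^ 2 ≤ 1 := by
    refine le_trans ?_ h2
    gcongr
    linarith
  apply abs_le_of_sq_le_sq' _ zero_le_one |>.2
  rw [mul_pow, mul_pow, sq_abs, Real.sq_sqrt hw]
  linarith

lemma nY_decay (α : ℝ) (hα : 0 ≤ α) (j : ℕ) : ∃ C : ℝ, 0 ≤ C ∧ ∀ (k : ℕ) (c t : ℝ),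
    2 * j + 2 ≤ k → |nY c α k 0 1| ≤ 1 → t ∈ Icc (-1 : ℝ) 1 → 1 ≤ k * √(1 - t ^ 2) →
    |nY c α k j t| * (k * √(1 - t ^ 2)) ^ j ≤ C := by
  induction j using Nat.twoStepInduction with
  | zero =>
    refine ⟨1, zero_le_one, fun k c t hk hc ht _ => ?_⟩
    simpa using nY_le_one c α hα k 0 (by omega) hc t ht
  | one =>
    refine ⟨1, zero_le_one, fun k c t hk hc ht _ => ?_⟩
    simpa using nY_one_decay c α hα k (by omega) hc t ht
  | more j ih1 ih2 =>
    obtain ⟨C1, hC1, h1⟩ := ih1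
    obtain ⟨C2, hC2, h2⟩ := ih2
    refine ⟨2 * (C1 + 2 * (α + j + 1) * C2), by positivity, fun k c t hk hc ht hr => ?_⟩
    have a1 := h1 k c t (by omega) hc ht hr
    have a2 := h2 k c t (by omega) hc ht hr
    have hw : 0 ≤ 1 - t ^ 2 := by nlinarith [ht.1, ht.2]
    have hrec := nY_rec c α k j (by omega) t
    set r := k * √(1 - t ^ 2) with hrdef
    have hr2 : r ^ 2 = k ^ 2 * (1 - t ^ 2) := by rw [hrdef, mul_pow, Real.sq_sqrt hw]
    have hk' : 2 * ((j : ℝ) + 2) + 2 ≤ k := by exact_mod_cast hk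
    have hj0 : (0 : ℝ) ≤ j := by positivity
    have hL : r ^ 2 / 2 ≤ ((k - (j + 1)) * (k + 2 * α + 1 + (j + 1))) * (1 - t ^ 2) := by
      rw [hr2, mul_div_right_comm]
      gcongr
      nlinarith
    have habs := congrArg abs hrec
    rw [abs_neg, abs_mul, abs_of_nonneg (le_trans (by positivity) hL)] at habs
    have ht1 : |t| ≤ 1 := abs_le.2 ht
    have hub : |nY c α k j t + 2 * (α + j + 1) * t * nY c α k (j + 1) t| ≤
        |nY c α k j t| + 2 * (α + j + 1) * |nY c α k (j + 1) t| := by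
      refine (abs_add_le _ _).trans ?_
      rw [abs_mul, abs_mul, abs_of_nonneg (by positivity : 0 ≤ 2 * (α + j + 1))]
      gcongr |nY c α k j t| + ?_ * |nY c α k (j + 1) t|
      exact mul_le_of_le_one_right (by positivity) ht1
    have h3 : r ^ 2 / 2 * |nY c α k (j + 2) t| ≤
        |nY c α k j t| + 2 * (α + j + 1) * |nY c α k (j + 1) t| :=
      (mul_le_mul_of_nonneg_right hL (abs_nonneg _)).trans (habs.le.trans hub)
    have hrp : 0 ≤ r ^ j := by positivity
    have h4 := mul_le_mul_of_nonneg_right h3 hrp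
    have h5 : |nY c α k (j + 1) t| * r ^ j ≤ C2 := by
      refine le_trans ?_ a2
      gcongr
      omega
    calc |nY c α k (j + 2) t| * r ^ (j + 2) = 2 * (r ^ 2 / 2 * |nY c α k (j + 2) t| * r ^ j) := by
          ring
      _ ≤ 2 * ((|nY c α k j t| + 2 * (α + j + 1) * |nY c α k (j + 1) t|) * r ^ j) := by gcongr
      _ = 2 * (|nY c α k j t| * r ^ j + 2 * (α + j + 1) * (|nY c α k (j + 1) t| * r ^ j)) := by
          ring
      _ ≤ _ := by gcongr

lemma near_one (f : ℝ → ℝ) (ν e i : ℝ) (he : e ≤ ν) (hei : e ≤ i) (p : Polynomial ℝ)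
    (h : (fun t : ℝ => f t - p.eval (1 - t)) =O[𝓝[<] (1 : ℝ)] fun t => (1 - t) ^ (ν - i)) :
    f =O[𝓝[<] (1 : ℝ)] fun t => (1 - t ^ 2) ^ (e - i) := by
  have hmem : ∀ᶠ t in 𝓝[<] (1 : ℝ), t ∈ Ioo (0 : ℝ) 1 := Ioo_mem_nhdsLT (by norm_num)
  have h1 : (fun t : ℝ => (1 - t) ^ (ν - i)) =O[𝓝[<] (1 : ℝ)] fun t => (1 - t ^ 2) ^ (e - i) := by
    refine IsBigO.of_bound ((1 / 2 : ℝ) ^ (e - i)) ?_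
    filter_upwards [hmem] with t ht
    have a : 0 < 1 - t := by linarith [ht.2]
    have b : 0 < 1 - t ^ 2 := by nlinarith [ht.1, ht.2]
    rw [Real.norm_of_nonneg (by positivity), Real.norm_of_nonneg (by positivity),
      ← Real.mul_rpow (by norm_num) b.le]
    calc (1 - t) ^ (ν - i) ≤ (1 - t) ^ (e - i) :=
          Real.rpow_le_rpow_of_exponent_ge a (by linarith [ht.1]) (by linarith)
      _ ≤ _ := Real.rpow_le_rpow_of_nonpos (by positivity) (by nlinarith [ht.1, ht.2])
          (by linarith)
  have h2 : (fun t : ℝ => p.eval (1 - t)) =O[𝓝[<] (1 : ℝ)] fun _ => (1 : ℝ) := by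
    have hc : Continuous fun t : ℝ => p.eval (1 - t) := by fun_prop
    exact (hc.continuousAt.isBigO_one ℝ).mono nhdsWithin_le_nhds
  have h3 : (fun _ : ℝ => (1 : ℝ)) =O[𝓝[<] (1 : ℝ)] fun t => (1 - t ^ 2) ^ (e - i) := by
    refine IsBigO.of_bound 1 ?_
    filter_upwards [hmem] with t ht
    have b : 0 < 1 - t ^ 2 := by nlinarith [ht.1, ht.2]
    rw [Real.norm_of_nonneg (by positivity), Real.norm_of_nonneg (by positivity), one_mul]
    exact Real.one_le_rpow_of_pos_of_le_one_of_nonpos b (by nlinarith) (by linarith)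
  have := (h.trans h1).add (h2.trans h3)
  simpa using this

lemma deriv_bound (f : ℝ → ℝ) (ν e i : ℝ) (he : e ≤ ν) (hei : e ≤ i)
    (hf : ContinuousOn f (Ioo (-1 : ℝ) 1)) (p q : Polynomial ℝ)
    (h : (fun t : ℝ => f t - p.eval (1 - t)) =O[𝓝[<] (1 : ℝ)] fun t => (1 - t) ^ (ν - i))
    (h' : (fun t : ℝ => f t - q.eval (1 + t)) =O[𝓝[>] (-1 : ℝ)] fun t => (1 + t) ^ (ν - i)) :
    ∃ C : ℝ, 0 ≤ C ∧ ∀ t ∈ Ioo (-1 : ℝ) 1, |f t| ≤ C * (1 - t ^ 2) ^ (e - i) := by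
  have a1 := near_one f ν e i he hei p h
  have hneg : Tendsto (fun t : ℝ => -t) (𝓝[<] (1 : ℝ)) (𝓝[>] (-1 : ℝ)) := tendsto_neg_nhdsLT
  have hneg' : Tendsto (fun t : ℝ => -t) (𝓝[>] (-1 : ℝ)) (𝓝[<] (1 : ℝ)) := by
    simpa using tendsto_neg_nhdsGT (a := (-1 : ℝ))
  have a2 : f =O[𝓝[>] (-1 : ℝ)] fun t => (1 - t ^ 2) ^ (e - i) := by
    have := near_one (fun t => f (-t)) ν e i he hei q (by
      simpa [Function.comp_def, sub_eq_add_neg] using h'.comp_tendsto hneg)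
    simpa [Function.comp_def] using this.comp_tendsto hneg'
  obtain ⟨C1, hC1⟩ := a1.bound
  obtain ⟨C2, hC2⟩ := a2.bound
  obtain ⟨b, hb, hb'⟩ := (mem_nhdsLT_iff_exists_Ioo_subset (a := (1 : ℝ))).1 hC1
  obtain ⟨a, ha, ha'⟩ := (mem_nhdsGT_iff_exists_Ioo_subset (a := (-1 : ℝ))).1 hC2
  have hb1 : b < 1 := hb
  have ha1 : -1 < a := ha
  set a0 := min a 0
  set b0 := max b 0
  have ha0 : -1 < a0 := lt_min ha1 (by norm_num)
  have hb0 : b0 < 1 := max_lt hb1 (by norm_num)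
  have hcont : ContinuousOn (fun t => f t / (1 - t ^ 2) ^ (e - i)) (Icc a0 b0) := by
    intro t ht
    have htm : t ∈ Ioo (-1 : ℝ) 1 := ⟨ha0.trans_le ht.1, ht.2.trans_lt hb0⟩
    have hw := one_sub_sq_pos htm
    have c1 : ContinuousAt (fun t : ℝ => (1 - t ^ 2) ^ (e - i)) t :=
      ContinuousAt.rpow_const (by fun_prop) (Or.inl hw.ne')
    exact (((hf.continuousAt (isOpen_Ioo.mem_nhds htm)).div c1
      (Real.rpow_pos_of_pos hw _).ne')).continuousWithinAt
  obtain ⟨C3, hC3⟩ := isCompact_Icc.exists_bound_of_continuousOn hcont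
  refine ⟨max 0 (max C1 (max C2 C3)), le_max_left _ _, fun t ht => ?_⟩
  have hw := one_sub_sq_pos ht
  have hwp : 0 < (1 - t ^ 2) ^ (e - i) := Real.rpow_pos_of_pos hw _
  have key : |f t| ≤ C1 * (1 - t ^ 2) ^ (e - i) ∨ |f t| ≤ C2 * (1 - t ^ 2) ^ (e - i) ∨
      |f t| ≤ C3 * (1 - t ^ 2) ^ (e - i) := by
    by_cases hB : b < t
    · left
      have := hb' ⟨hB, ht.2⟩
      simpa [abs_of_pos hwp] using this
    · by_cases hA : t < a
      · right; left
        have := ha' ⟨ht.1, hA⟩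
        simpa [abs_of_pos hwp] using this
      · right; right
        have := hC3 t ⟨(min_le_left _ _).trans (not_lt.1 hA), (not_lt.1 hB).trans (le_max_left _ _)⟩
        rw [norm_div, Real.norm_of_nonneg hwp.le, div_le_iff₀ hwp] at this
        exact this
  rcases key with h | h | h <;> refine h.trans ?_ <;> gcongr <;> simp

lemma nY_cont (c α : ℝ) (k j : ℕ) : Continuous (nY c α k j) := by
  unfold nY; fun_prop

lemma F_bound (g : ℝ → ℝ) (c α C e i : ℝ) (k j : ℕ) (hC : 0 ≤ C)
    (hg : ∀ t ∈ Ioo (-1 : ℝ) 1, |g t| ≤ C * (1 - t ^ 2) ^ (-i)) :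
    ∃ M : ℝ, ∀ t ∈ Ioo (-1 : ℝ) 1,
      ‖g t * (nY c α k j t * (1 - t ^ 2) ^ (e + i))‖ ≤ M * (1 - t ^ 2) ^ e := by
  obtain ⟨N, hN⟩ := (isCompact_Icc (a := (-1 : ℝ)) (b := 1)).exists_bound_of_continuousOn
    (nY_cont c α k j).continuousOn
  refine ⟨C * N, fun t ht => ?_⟩
  have hw := one_sub_sq_pos ht
  have h1 := hg t ht
  have h2 := hN t (Ioo_subset_Icc_self ht)
  have h3 : (1 - t ^ 2) ^ e = (1 - t ^ 2) ^ (-i) * (1 - t ^ 2) ^ (e + i) := by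
    rw [← Real.rpow_add hw]; congr 1; ring
  rw [norm_mul, norm_mul, Real.norm_of_nonneg (by positivity : 0 ≤ (1 - t ^ 2) ^ (e + i)), h3]
  calc ‖g t‖ * (‖nY c α k j t‖ * (1 - t ^ 2) ^ (e + i))
      ≤ (C * (1 - t ^ 2) ^ (-i)) * (N * (1 - t ^ 2) ^ (e + i)) := by gcongr; exact h1
    _ = _ := by ring

lemma F_integrable (g : ℝ → ℝ) (c α C e i : ℝ) (k j : ℕ) (hC : 0 ≤ C) (he : 0 ≤ e)
    (hgc : ContinuousOn g (Ioo (-1 : ℝ) 1))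
    (hg : ∀ t ∈ Ioo (-1 : ℝ) 1, |g t| ≤ C * (1 - t ^ 2) ^ (-i)) :
    IntervalIntegrable (fun t => g t * (nY c α k j t * (1 - t ^ 2) ^ (e + i)))
      MeasureTheory.volume (-1) 1 := by
  obtain ⟨M, hM⟩ := F_bound g c α C e i k j hC hg
  rw [intervalIntegrable_iff_integrableOn_Ioo_of_le (by norm_num)]
  refine ⟨?_, .restrict_of_bounded (C := |M|) (by simp) ?_⟩
  · apply ContinuousOn.aestronglyMeasurable _ measurableSet_Ioo
    refine hgc.mul ((nY_cont c α k j).continuousOn.mul ?_)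
    exact ContinuousOn.rpow_const (by fun_prop) fun t ht => Or.inl (one_sub_sq_pos ht).ne'
  · filter_upwards [MeasureTheory.ae_restrict_mem measurableSet_Ioo] with t ht
    refine (hM t ht).trans ?_
    have hw := one_sub_sq_pos ht
    have : (1 - t ^ 2) ^ e ≤ 1 := Real.rpow_le_one hw.le (by nlinarith) he
    calc M * (1 - t ^ 2) ^ e ≤ |M| * (1 - t ^ 2) ^ e := by gcongr; exact le_abs_self _
      _ ≤ |M| * 1 := by gcongr
      _ = |M| := mul_one _

lemma ibp (g dg : ℝ → ℝ) (c α C C' : ℝ) (hα : 0 ≤ α) (k i : ℕ) (hi : i < k)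
    (hC : 0 ≤ C) (hC' : 0 ≤ C')
    (hd : ∀ t ∈ Ioo (-1 : ℝ) 1, HasDerivAt g (dg t) t)
    (hgc' : ContinuousOn dg (Ioo (-1 : ℝ) 1))
    (hg : ∀ t ∈ Ioo (-1 : ℝ) 1, |g t| ≤ C * (1 - t ^ 2) ^ (-(i : ℝ)))
    (hg' : ∀ t ∈ Ioo (-1 : ℝ) 1, |dg t| ≤ C' * (1 - t ^ 2) ^ (-((i + 1 : ℕ) : ℝ))) :
    ∫ t in (-1 : ℝ)..1, g t * (nY c α k i t * (1 - t ^ 2) ^ (α + i)) =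
      - ∫ t in (-1 : ℝ)..1, dg t * (nY c α k (i + 1) t * (1 - t ^ 2) ^ (α + (i + 1 : ℕ))) := by
  have hgc : ContinuousOn g (Ioo (-1 : ℝ) 1) := fun t ht =>
    (hd t ht).continuousAt.continuousWithinAt
  have I1 := F_integrable g c α C α i k i hC hα hgc hg
  have I2 := F_integrable dg c α C' α (i + 1 : ℕ) k (i + 1) hC' hα hgc' hg'
  obtain ⟨M, hM⟩ := F_bound g c α C (α + 1) i k (i + 1) hC hg
  have hzero : ∀ x : ℝ, x ^ 2 = 1 → Tendsto (fun t : ℝ => M * (1 - t ^ 2) ^ (α + 1)) (𝓝 x) (𝓝 0) := by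
    intro x hx
    have : Continuous fun t : ℝ => M * (1 - t ^ 2) ^ (α + 1) := by
      refine continuous_const.mul (Continuous.rpow_const (by fun_prop) fun _ => Or.inr (by linarith))
    have h := this.tendsto x
    simpa [hx, Real.zero_rpow (by linarith : α + 1 ≠ 0)] using h
  have key := intervalIntegral.integral_eq_sub_of_hasDerivAt_of_tendsto (a := (-1 : ℝ)) (b := 1)
    (f := fun t => g t * (nY c α k (i + 1) t * (1 - t ^ 2) ^ (α + 1 + i)))
    (f' := fun t => dg t * (nY c α k (i + 1) t * (1 - t ^ 2) ^ (α + (i + 1 : ℕ))) +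
      g t * (nY c α k i t * (1 - t ^ 2) ^ (α + i))) (fa := 0) (fb := 0) (by norm_num)
    (fun t ht => ?_) (I2.add I1) ?_ ?_
  · rw [intervalIntegral.integral_add I2 I1] at key
    linarith
  · obtain ⟨n, rfl⟩ : ∃ n, k = n + 1 + i := ⟨k - i - 1, by omega⟩
    have h := (rod_hasDerivAt ((n + 1 + i : ℕ) + α) (α + 1 + i) n t ht
      (by push_cast; ring)).const_mul c
    have h2 := (hd t ht).mul h
    unfold nY
    rw [show n + 1 + i - i = n + 1 by omega, show n + 1 + i - (i + 1) = n by omega]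
    rw [show α + 1 + (i : ℝ) - 1 = α + i by ring] at h2
    have h3 : ((fun t => g t * (c * Polynomial.eval t (rodQ (((n + 1 + i : ℕ) : ℝ) + α) n) *
        (1 - t ^ 2) ^ (α + 1 + i)))) = (g * fun y => c * (Polynomial.eval y
          (rodQ (((n + 1 + i : ℕ) : ℝ) + α) n) * (1 - y ^ 2) ^ (α + 1 + (i : ℝ)))) := by
      ext t; simp [mul_assoc]
    rw [h3]
    refine h2.congr_deriv ?_
    rw [show α + ((i + 1 : ℕ) : ℝ) = α + 1 + i by push_cast; ring]
    ring
  · refine squeeze_zero_norm' ?_ ((hzero (-1) (by norm_num)).mono_left nhdsWithin_le_nhds)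
    filter_upwards [Ioo_mem_nhdsGT (by norm_num : (-1 : ℝ) < 1)] with t ht using hM t ht
  · refine squeeze_zero_norm' ?_ ((hzero 1 (by norm_num)).mono_left nhdsWithin_le_nhds)
    filter_upwards [Ioo_mem_nhdsLT (by norm_num : (-1 : ℝ) < 1)] with t ht using hM t ht

lemma iter_hasDerivAt (κ : ℝ → ℝ) (hκ : ContDiffOn ℝ (⊤ : ℕ∞) κ (Set.Ioo (-1 : ℝ) 1)) (i : ℕ) :
    ∀ t ∈ Ioo (-1 : ℝ) 1, HasDerivAt (iteratedDeriv i κ) (iteratedDeriv (i + 1) κ t) t := by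
  intro t ht
  have h1 : DifferentiableOn ℝ (iteratedDerivWithin i κ (Ioo (-1) 1)) (Ioo (-1 : ℝ) 1) :=
    hκ.differentiableOn_iteratedDerivWithin (by exact_mod_cast ENat.natCast_lt_top i)
      isOpen_Ioo.uniqueDiffOn
  have h3 : DifferentiableAt ℝ (iteratedDeriv i κ) t :=
    (h1.congr fun x hx => (iteratedDerivWithin_of_isOpen isOpen_Ioo hx).symm).differentiableAt
      (isOpen_Ioo.mem_nhds ht)
  rw [iteratedDeriv_succ]
  exact h3.hasDerivAt

lemma integrand_eq (d k : ℕ) (κ : ℝ → ℝ) (t : ℝ) (ht : t ∈ Ioo (-1 : ℝ) 1) :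
    κ t * legendreP d k t * (1 - t ^ 2) ^ (((d : ℝ) - 3) / 2) =
    iteratedDeriv 0 κ t * (nY ((-1 / 2 : ℝ) ^ k *
      (Gamma (((d : ℝ) - 3) / 2 + 1) / Gamma (k + ((d : ℝ) - 3) / 2 + 1)))
        (((d : ℝ) - 3) / 2) k 0 t * (1 - t ^ 2) ^ (((d : ℝ) - 3) / 2 + (0 : ℕ))) := by
  have hw := one_sub_sq_pos ht
  unfold legendreP nY
  rw [rod_iteratedDeriv _ _ _ ht]
  have e1 : ((d : ℝ) - 1) / 2 = ((d : ℝ) - 3) / 2 + 1 := by ring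
  have e2 : (k : ℝ) + ((d : ℝ) - 3) / 2 - k = ((d : ℝ) - 3) / 2 := by ring
  have e3 : (1 - t ^ 2) ^ ((3 - (d : ℝ)) / 2) * (1 - t ^ 2) ^ (((d : ℝ) - 3) / 2) = 1 := by
    rw [← Real.rpow_add hw, show (3 - (d : ℝ)) / 2 + ((d : ℝ) - 3) / 2 = 0 by ring, Real.rpow_zero]
  rw [e1, e2, ← add_assoc]
  simp only [iteratedDeriv_zero, Nat.sub_zero, Nat.cast_zero, add_zero]
  linear_combination κ t * ((-1 / 2 : ℝ) ^ k *
      (Gamma (((d : ℝ) - 3) / 2 + 1) / Gamma (k + ((d : ℝ) - 3) / 2 + 1))) *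
      Polynomial.eval t (rodQ (k + ((d : ℝ) - 3) / 2) k) * (1 - t ^ 2) ^ (((d : ℝ) - 3) / 2) * e3

lemma pointwise (α ν C x y w K : ℝ) (j : ℕ) (hα : 0 ≤ α) (hν : 0 < ν) (hj : 2 * (ν + α) ≤ j)
    (hK : 1 ≤ K) (hw : 0 < w) (hC : 0 ≤ C) (A : ℝ) (hA : 0 ≤ A)
    (hx : |x| ≤ A * w ^ (ν - j)) (hy1 : |y| ≤ 1)
    (hy : 1 ≤ K * √w → |y| * (K * √w) ^ j ≤ C) :
    ‖x * (y * w ^ (α + j))‖ ≤ A * max 1 C * K ^ (-(2 * (ν + α))) := by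
  have h3 : w ^ (ν + α) = w ^ (ν - j) * w ^ (α + j) := by
    rw [← Real.rpow_add hw]; congr 1; ring
  have h1 : ‖x * (y * w ^ (α + j))‖ ≤ A * (|y| * w ^ (ν + α)) := by
    rw [norm_mul, norm_mul, Real.norm_of_nonneg (by positivity : 0 ≤ w ^ (α + j)), h3]
    calc ‖x‖ * (‖y‖ * w ^ (α + j)) ≤ (A * w ^ (ν - j)) * (‖y‖ * w ^ (α + j)) := by
          gcongr; exact hx
      _ = _ := by simp only [Real.norm_eq_abs]; ring
  refine h1.trans ?_
  rw [mul_assoc]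
  refine mul_le_mul_of_nonneg_left ?_ hA
  have hK0 : 0 < K := by linarith
  set r := K * √w with hr
  have hr0 : 0 < r := by positivity
  have hwr : w ^ (ν + α) = r ^ (2 * (ν + α)) * K ^ (-(2 * (ν + α))) := by
    rw [hr, Real.mul_rpow hK0.le (Real.sqrt_nonneg _), mul_right_comm, ← Real.rpow_add hK0,
      add_neg_cancel, Real.rpow_zero, one_mul, Real.rpow_mul (Real.sqrt_nonneg _)]
    congr 1
    rw [Real.rpow_two, Real.sq_sqrt hw.le]
  rw [hwr, ← mul_assoc]
  refine mul_le_mul_of_nonneg_right ?_ (by positivity)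
  rcases le_total 1 r with h | h
  · refine le_trans ?_ ((hy h).trans (le_max_right _ _))
    gcongr
    rw [← Real.rpow_natCast]
    exact Real.rpow_le_rpow_of_exponent_le h hj
  · refine le_trans ?_ (le_max_left _ _)
    exact mul_le_one₀ hy1 (by positivity) (Real.rpow_le_one hr0.le h (by positivity))

/-- Weak upper bound on the decay of the Legendre coefficients from regularity of `κ`
up to terms of order `ν` at the endpoints. -/
theorem weak_decay_upper_bound (d : ℕ) (hd : 3 ≤ d) (ν : ℝ) (hν : 0 < ν) (κ : ℝ → ℝ)
    (hκ : ContDiffOn ℝ (⊤ : ℕ∞) κ (Set.Ioo (-1 : ℝ) 1))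
    (hexp1 : ∀ j : ℕ, ∃ p : Polynomial ℝ,
      (fun t : ℝ => iteratedDeriv j κ t - p.eval (1 - t))
        =O[𝓝[<] (1 : ℝ)] fun t => (1 - t) ^ (ν - j))
    (hexpm1 : ∀ j : ℕ, ∃ p : Polynomial ℝ,
      (fun t : ℝ => iteratedDeriv j κ t - p.eval (1 + t))
        =O[𝓝[>] (-1 : ℝ)] fun t => (1 + t) ^ (ν - j)) :
    (fun k : ℕ => legendreCoeff d k κ) =O[atTop] fun k => (k : ℝ) ^ (-(d : ℝ) - 2 * ν + 3) := by
  set α : ℝ := ((d : ℝ) - 3) / 2 with hαdef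
  have hd' : (3 : ℝ) ≤ d := by exact_mod_cast hd
  have hα : 0 ≤ α := by rw [hαdef]; linarith
  have hder := iter_hasDerivAt κ hκ
  have hcont : ∀ i, ContinuousOn (iteratedDeriv i κ) (Ioo (-1 : ℝ) 1) := fun i t ht =>
    (hder i t ht).continuousAt.continuousWithinAt
  have hB : ∀ i : ℕ, ∃ C : ℝ, 0 ≤ C ∧ ∀ t ∈ Ioo (-1 : ℝ) 1,
      |iteratedDeriv i κ t| ≤ C * (1 - t ^ 2) ^ (-(i : ℝ)) := by
    intro i
    obtain ⟨p, hp⟩ := hexp1 i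
    obtain ⟨q, hq⟩ := hexpm1 i
    simpa using deriv_bound _ ν 0 i hν.le (by positivity) (hcont i) p q hp hq
  choose B hB0 hB using hB
  obtain ⟨j, hj⟩ := exists_nat_ge (2 * (ν + α))
  obtain ⟨A, hA0, hA⟩ : ∃ C : ℝ, 0 ≤ C ∧ ∀ t ∈ Ioo (-1 : ℝ) 1,
      |iteratedDeriv j κ t| ≤ C * (1 - t ^ 2) ^ (ν - j) := by
    obtain ⟨p, hp⟩ := hexp1 j
    obtain ⟨q, hq⟩ := hexpm1 j
    exact deriv_bound _ ν ν j le_rfl (by linarith) (hcont j) p q hp hq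
  obtain ⟨C, hC0, hC⟩ := nY_decay α hα j
  refine IsBigO.of_bound (|sphereSurface (d - 1) / sphereSurface d| * (A * max 1 C * 2)) ?_
  filter_upwards [eventually_ge_atTop (2 * j + 2)] with k hk
  have hk1 : (1 : ℝ) ≤ k := by exact_mod_cast (by omega : 1 ≤ k)
  set c : ℝ := (-1 / 2 : ℝ) ^ k * (Gamma (α + 1) / Gamma (k + α + 1)) with hc
  have hc1 : |nY c α k 0 1| ≤ 1 := by
    have := norm_const α hα k
    unfold nY
    rw [Nat.sub_zero, this, abs_one]
  have e0 : ∫ t in (-1 : ℝ)..1, κ t * legendreP d k t * (1 - t ^ 2) ^ α =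
      ∫ t in (-1 : ℝ)..1, iteratedDeriv 0 κ t * (nY c α k 0 t * (1 - t ^ 2) ^ (α + (0 : ℕ))) := by
    rw [intervalIntegral.integral_of_le (by norm_num), intervalIntegral.integral_of_le (by norm_num),
      MeasureTheory.integral_Ioc_eq_integral_Ioo, MeasureTheory.integral_Ioc_eq_integral_Ioo]
    exact MeasureTheory.setIntegral_congr_fun measurableSet_Ioo
      fun t ht => integrand_eq d k κ t ht
  have e1 : ∀ i : ℕ, i ≤ k → |∫ t in (-1 : ℝ)..1, κ t * legendreP d k t * (1 - t ^ 2) ^ α| =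
      |∫ t in (-1 : ℝ)..1, iteratedDeriv i κ t * (nY c α k i t * (1 - t ^ 2) ^ (α + (i : ℕ)))| := by
    intro i
    induction i with
    | zero => intro _; rw [e0]
    | succ i ih =>
      intro hi
      rw [ih (by omega), ibp _ _ c α (B i) (B (i + 1)) hα k i (by omega) (hB0 i) (hB0 (i + 1))
        (hder i) (hcont (i + 1)) (hB i) (hB (i + 1)), abs_neg]
  have e2 : ‖∫ t in (-1 : ℝ)..1, iteratedDeriv j κ t * (nY c α k j t * (1 - t ^ 2) ^ (α + (j : ℕ)))‖
      ≤ (A * max 1 C * (k : ℝ) ^ (-(2 * (ν + α)))) * |1 - (-1)| := by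
    apply intervalIntegral.norm_integral_le_of_norm_le_const_ae
    have : ∀ᵐ t : ℝ, t ≠ 1 := by
      simp [MeasureTheory.ae_iff]
    filter_upwards [this] with t ht1 ht
    rw [uIoc_of_le (by norm_num)] at ht
    have ht' : t ∈ Ioo (-1 : ℝ) 1 := ⟨ht.1, lt_of_le_of_ne ht.2 ht1⟩
    exact pointwise α ν C _ _ _ k j hα hν hj hk1 (one_sub_sq_pos ht') hC0 A hA0 (hA t ht')
      (nY_le_one c α hα k j (by omega) hc1 t (Ioo_subset_Icc_self ht'))
      (hC k c t hk hc1 (Ioo_subset_Icc_self ht'))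
  unfold legendreCoeff
  rw [norm_mul, Real.norm_eq_abs, Real.norm_eq_abs, e1 j (by omega),
    Real.norm_of_nonneg (by positivity), mul_assoc]
  gcongr
  rw [Real.norm_eq_abs] at e2
  refine e2.trans (le_of_eq ?_)
  rw [show -(d : ℝ) - 2 * ν + 3 = -(2 * (ν + α)) by rw [hαdef]; ring]
  norm_num
  ring
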